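/- arXiv:1006.3156 — 2 statements merged into one kernel-verified Lean document; each statement's English description precedes it below -/
import Mathlib

section
/- Let C be an observable (n,k,δ) maximum distance profile (MDP) convolutional code over a finite field F and set L = ⌊δ/k⌋ + ⌊δ/(n−k)⌋. Let E ⊆ ℕ×{1,…,n} be a set of erased coefficient positions such that every sliding window {t, …, t+L}×{1,…,n} (of length (L+1)n) contains at most (L+1)(n−k) elements of E. Then any two codewords of C agreeing at every coefficient position outside E are equal; hence the transmitted sequence can be completely recovered by iteratively decoding the symbols from left to right. -/
open Polynomial Matrix

/-- Weight of the `j`-th truncation `v₀ + v₁ z + ⋯ + v_j z^j` of a vector of polynomials. -/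
noncomputable def truncWeight {F : Type*} [Semiring F] {n : ℕ} (j : ℕ)
    (v : Fin n → Polynomial F) : ℕ :=
  ∑ c : Fin n, ((v c).support.filter (fun i => i ≤ j)).card

/-- `d` is the `j`-th column distance of the code `C`. -/
def IsColDist {F : Type*} [Semiring F] {n : ℕ} (C : Set (Fin n → Polynomial F))
    (j d : ℕ) : Prop :=
  IsLeast {w | ∃ v ∈ C, (fun c => (v c).coeff 0) ≠ 0 ∧ truncWeight j v = w} d

/-- `δ` is the degree of the convolutional code with generator matrix `G`:
the maximal degree of the (nonzero) `k × k` minors of `G`. -/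
def IsCodeDegree {F : Type*} [Field F] {n k : ℕ} (G : Matrix (Fin n) (Fin k) (Polynomial F))
    (δ : ℕ) : Prop :=
  IsGreatest {d | ∃ e : Fin k ↪ Fin n,
    (G.submatrix (⇑e) id).det ≠ 0 ∧ ((G.submatrix (⇑e) id).det).natDegree = d} δ

/-- A nonzero vector of polynomials is a power of `X` times a vector with nonzero constant term. -/
theorem exists_eq_X_pow_smul {F ι : Type*} [CommSemiring F] {v : ι → Polynomial F} (hv : v ≠ 0) :
    ∃ (t : ℕ) (x : ι → Polynomial F),
      v = (X ^ t : Polynomial F) • x ∧ (fun c => (x c).coeff 0) ≠ 0 := by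
  classical
  have hex : ∃ i, ∃ c, (v c).coeff i ≠ 0 := by
    by_contra! h
    exact hv (funext fun c => Polynomial.ext fun i => by simpa using h i c)
  have hdvd : ∀ c, (X ^ Nat.find hex : Polynomial F) ∣ v c := fun c =>
    X_pow_dvd_iff.2 fun i hi => by
      by_contra h
      exact Nat.find_min hex hi ⟨c, h⟩
  choose x hx using hdvd
  refine ⟨Nat.find hex, x, funext hx, fun h0 => ?_⟩
  obtain ⟨c, hc⟩ := Nat.find_spec hex
  apply hc
  rw [hx c, coeff_X_pow_mul']
  simpa using congrFun h0 c

/-- The truncated weight of `x` is at most the size of any finite set of positions that contains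
the translate by `t` of every nonzero position of the truncation. -/
theorem truncWeight_le_ncard {F : Type*} [Semiring F] {n j t : ℕ} {x : Fin n → Polynomial F}
    {S : Set (ℕ × Fin n)} (hS : S.Finite)
    (h : ∀ i c, i ≤ j → (x c).coeff i ≠ 0 → (i + t, c) ∈ S) :
    truncWeight j x ≤ S.ncard := by
  classical
  unfold truncWeight
  rw [← Finset.card_sigma, ← Set.ncard_coe_finset]
  refine Set.ncard_le_ncard_of_injOn (fun p => (p.2 + t, p.1)) ?_ ?_ hS
  · rintro ⟨c, i⟩ hp
    simp only [Finset.coe_sigma, Set.mem_sigma_iff, Finset.mem_coe, Finset.mem_filter,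
      mem_support_iff] at hp
    exact h i c hp.2.2 hp.2.1
  · rintro ⟨c, i⟩ - ⟨c', i'⟩ - heq
    simp only [Prod.mk.injEq, Nat.add_right_cancel_iff] at heq
    obtain ⟨rfl, rfl⟩ := heq
    rfl

/-- an observable `(n,k,δ)` MDP convolutional code recovers every erasure
pattern with at most `(L+1)(n-k)` erasures in each sliding window of length `(L+1)n`. -/
theorem stmt_2 {F : Type*} [Field F] [Fintype F] {n k δ : ℕ} (hk : 0 < k) (hkn : k < n)
    (G : Matrix (Fin n) (Fin k) (Polynomial F))
    (hGfull : ∃ e : Fin k ↪ Fin n, (G.submatrix (⇑e) id).det ≠ 0)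
    (hδ : IsCodeDegree G δ)
    (H : Matrix (Fin (n - k)) (Fin n) (Polynomial F))
    (hHfull : ∃ e : Fin (n - k) ↪ Fin n, (H.submatrix id (⇑e)).det ≠ 0)
    (C : Set (Fin n → Polynomial F))
    (hCgen : C = {v | ∃ u : Fin k → Polynomial F, v = G.mulVec u})
    (hCpc : C = {v | H.mulVec v = 0})
    (L : ℕ) (hL : L = δ / k + δ / (n - k))
    (hMDP : IsColDist C L ((n - k) * (L + 1) + 1))
    (E : Set (ℕ × Fin n))
    (hE : ∀ t : ℕ, {p : ℕ × Fin n | p ∈ E ∧ t ≤ p.1 ∧ p.1 ≤ t + L}.ncard ≤ (L + 1) * (n - k)) :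
    ∀ v ∈ C, ∀ w ∈ C,
      (∀ (i : ℕ) (c : Fin n), (i, c) ∉ E → (v c).coeff i = (w c).coeff i) → v = w := by
  intro v hv w hw hvw
  by_contra hne
  obtain ⟨t, x, hx, hx0⟩ := exists_eq_X_pow_smul (sub_ne_zero.2 hne)
  have hxC : x ∈ C := by
    rw [hCpc] at hv hw ⊢
    have h : (X ^ t : Polynomial F) • H.mulVec x = 0 := by
      rw [← Matrix.mulVec_smul, ← hx, Matrix.mulVec_sub, hv, hw, sub_zero]
    exact (smul_eq_zero.1 h).resolve_left (pow_ne_zero t X_ne_zero)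
  have hfin : {p : ℕ × Fin n | p ∈ E ∧ t ≤ p.1 ∧ p.1 ≤ t + L}.Finite :=
    ((Set.finite_Icc t (t + L)).prod Set.finite_univ).subset
      fun p hp => ⟨⟨hp.2.1, hp.2.2⟩, Set.mem_univ _⟩
  have hupper : truncWeight L x ≤ (L + 1) * (n - k) := by
    refine (truncWeight_le_ncard (t := t) hfin fun i c hi hne0 => ⟨?_, ?_, ?_⟩).trans (hE t)
    · by_contra hEic
      apply hne0
      rw [← coeff_X_pow_mul (x c) t i]
      have hc : v c - w c = X ^ t * x c := congrFun hx c
      rw [← hc, coeff_sub, hvw _ _ hEic, sub_self]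
    · exact Nat.le_add_left t i
    · change i + t ≤ t + L
      omega
  have hlower : (n - k) * (L + 1) + 1 ≤ truncWeight L x := hMDP.2 ⟨x, hxC, hx0, rfl⟩
  rw [mul_comm] at hupper
  omega
end

section
/- Let F be a finite field, α ∈ F nonzero, and let a(z) = Π_{i=0}^{l−1}(1 + α^i z) with A the (l+1)×(l+1) lower triangular Toeplitz matrix built from the coefficients of a(z); assume A is superregular (as in the construction of reverse-superregular matrices). Let s(z) = Π_{i=0}^{l−1}(1 + (α^{−1})^i z) = s_0 + s_1 z + ⋯ + s_l z^l and let S be the (l+1)×(l+1) lower triangular Toeplitz matrix with first column (s_0, s_1, …, s_l). Then S is reverse-superregular. -/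
open Polynomial Matrix

/-- The `r × r` lower triangular Toeplitz matrix with first column `a 0, a 1, …, a (r-1)`. -/
def ltToeplitz {F : Type*} [Zero F] (r : ℕ) (a : ℕ → F) : Matrix (Fin r) (Fin r) F :=
  Matrix.of fun i j => if (j : ℕ) ≤ (i : ℕ) then a ((i : ℕ) - (j : ℕ)) else 0

/-- A lower triangular Toeplitz matrix is superregular if every proper submatrix
(rows `I`, columns `J` with `j_t ≤ i_t` for all `t`) has nonzero determinant. -/
def Superregular {F : Type*} [Field F] {r : ℕ} (A : Matrix (Fin r) (Fin r) F) : Prop :=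
  ∀ (s : ℕ) (I J : Fin s → Fin r), StrictMono I → StrictMono J →
    (∀ t, (J t : ℕ) ≤ (I t : ℕ)) → (A.submatrix I J).det ≠ 0

/-- The `(l+1) × (l+1)` lower triangular Toeplitz matrix with first column
`a 0, …, a l` is reverse-superregular. -/
def RevSuperregular {F : Type*} [Field F] (l : ℕ) (a : ℕ → F) : Prop :=
  Superregular (ltToeplitz (l + 1) a) ∧
    Superregular (ltToeplitz (l + 1) (fun m => a (l - m)))

/-- Superregularity is preserved when the generating sequence is multiplied by a nonzero
geometric sequence. -/
lemma Superregular.ltToeplitz_of_eq_geom_mul {F : Type*} [Field F] {r : ℕ} {a b : ℕ → F} {c β : F}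
    (hc : c ≠ 0) (hβ : β ≠ 0) (hab : ∀ m < r, b m = c * β ^ m * a m)
    (ha : Superregular (ltToeplitz r a)) : Superregular (ltToeplitz r b) := by
  intro s I J hI hJ hIJ
  have h : (ltToeplitz r b).submatrix I J =
      diagonal (fun t => c * β ^ (I t : ℕ)) * (ltToeplitz r a).submatrix I J *
        diagonal (fun t => (β ^ (J t : ℕ))⁻¹) := by
    ext p q
    simp only [mul_diagonal, diagonal_mul, submatrix_apply, ltToeplitz, of_apply]
    split_ifs with hqp
    · rw [hab _ (by omega), pow_sub₀ _ hβ hqp]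
      ring
    · simp
  rw [h, det_mul, det_mul, det_diagonal, det_diagonal]
  refine mul_ne_zero (mul_ne_zero ?_ (ha s I J hI hJ hIJ)) ?_
  · exact Finset.prod_ne_zero_iff.2 fun t _ => mul_ne_zero hc (pow_ne_zero _ hβ)
  · exact Finset.prod_ne_zero_iff.2 fun t _ => inv_ne_zero (pow_ne_zero _ hβ)

lemma Polynomial.natDegree_prod_one_add_C_mul_X_le {R : Type*} [CommSemiring R] (f : ℕ → R)
    (n : ℕ) : (∏ i ∈ Finset.range n, (1 + C (f i) * X)).natDegree ≤ n := by
  refine (natDegree_prod_le _ _).trans ((Finset.sum_le_card_nsmul _ _ 1 fun i _ => ?_).trans ?_)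
  · compute_degree
  · simp

lemma Polynomial.reflect_prod_one_add_C_mul_X {R : Type*} [CommSemiring R] (f : ℕ → R) (n : ℕ) :
    reflect n (∏ i ∈ Finset.range n, (1 + C (f i) * X)) =
      ∏ i ∈ Finset.range n, (X + C (f i)) := by
  induction n with
  | zero => simp
  | succ n ih =>
    rw [Finset.prod_range_succ, Finset.prod_range_succ,
      reflect_mul _ _ (natDegree_prod_one_add_C_mul_X_le f n) (by compute_degree), ih]
    congr 1
    simp [reflect_add, reflect_C_mul, reflect_one]

/-- let `a(z) = ∏_{i=0}^{l-1}(1 + αⁱ z)` with superregular associated lower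
triangular Toeplitz matrix `A`, and let `s(z) = ∏_{i=0}^{l-1}(1 + (α⁻¹)ⁱ z)`. Then the
lower triangular Toeplitz matrix `S` built from the coefficients of `s(z)` is
reverse-superregular. -/
theorem stmt_11 {F : Type*} [Field F] [Fintype F] (l : ℕ) (α : F) (hα : α ≠ 0)
    (a : ℕ → F)
    (ha : ∀ m, a m = (∏ i ∈ Finset.range l, (1 + C (α ^ i) * X)).coeff m)
    (hA : Superregular (ltToeplitz (l + 1) a))
    (s : ℕ → F)
    (hs : ∀ m, s m = (∏ i ∈ Finset.range l, (1 + C ((α⁻¹) ^ i) * X)).coeff m) :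
    RevSuperregular l s := by
  refine ⟨hA.ltToeplitz_of_eq_geom_mul one_ne_zero (pow_ne_zero (l - 1) (inv_ne_zero hα)) ?_,
    hA.ltToeplitz_of_eq_geom_mul (c := ∏ i ∈ Finset.range l, α⁻¹ ^ i)
      (Finset.prod_ne_zero_iff.2 fun i _ => pow_ne_zero i (inv_ne_zero hα)) one_ne_zero ?_⟩
  · intro m _
    rw [hs, ha, one_mul, mul_comm, ← comp_C_mul_X_coeff, prod_comp, ← Finset.prod_range_reflect]
    congr 1
    refine Finset.prod_congr rfl fun i hi => ?_
    have hi' : i ≤ l - 1 := by have := Finset.mem_range.1 hi; omega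
    have h : α⁻¹ ^ (l - 1 - i) = α ^ i * α⁻¹ ^ (l - 1) := by
      rw [pow_sub₀ _ (inv_ne_zero hα) hi', inv_pow α i, inv_inv, mul_comm]
    simp [h, mul_assoc]
  · intro m hm
    have hm' : m ≤ l := by omega
    rw [hs, ha, one_pow, mul_one, ← revAt_le hm', ← coeff_reflect,
      reflect_prod_one_add_C_mul_X, ← coeff_C_mul, map_prod, ← Finset.prod_mul_distrib]
    congr 1
    refine Finset.prod_congr rfl fun i _ => ?_
    rw [mul_add, ← mul_assoc, ← C_mul, ← mul_pow, inv_mul_cancel₀ hα]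
    simp [add_comm]
end
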